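/- (Relation R2 of the intermediate Wakimoto realization.) For all 1 ≤ i, j ≤ n and all m, p ∈ ℤ, [ρ(H_i)_m, ρ(E_j)_p] = (α_i|α_j) · ρ(E_j)_{m+p} as linear operators on ℂ[x] ⊗ ℂ[y]. -/

import Mathlib

open MvPolynomial

/-- The Cartan matrix of `sl(n+1, ℂ)` (indices `0, …, n-1` represent `1, …, n`). -/
def cartan (n : ℕ) (i j : Fin n) : ℤ :=
  if i = j then 2 else if (i : ℕ) + 1 = (j : ℕ) ∨ (j : ℕ) + 1 = (i : ℕ) then -1 else 0

/-- The pairing `(α_i | α_{kl}) = Σ_{s=k}^{l} A_{is}` of a simple root with the positive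
root `α_k + ⋯ + α_l`. -/
def pairRoot (n : ℕ) (i k l : Fin n) : ℤ :=
  ∑ s ∈ Finset.Icc k l, cartan n i s

/-- The matrix `𝔅_{ij} = (α_i|α_j)(γ² − δ_{i>r}δ_{j>r}(r+1) + (r/2)δ_{i,r+1}δ_{j,r+1})`. -/
noncomputable def Bmat (n r : ℕ) (γ : ℂ) (i j : Fin n) : ℂ :=
  (cartan n i j : ℂ) *
    (γ ^ 2 - (if r < (i : ℕ) + 1 ∧ r < (j : ℕ) + 1 then (r : ℂ) + 1 else 0)
      + (if (i : ℕ) = r ∧ (j : ℕ) = r then (r : ℂ) / 2 else 0))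

/-- Index type for the variables of `ℂ[x] ⊗ ℂ[y] ≅ ℂ[x, y]`:  left summands index the
variables `x_{ij,m}` (`1 ≤ i ≤ j ≤ n`, `m ∈ ℤ`; only indices with `i ≤ j` are used),
right summands index the variables `y_{i,m}` (`1 ≤ i ≤ n`, `m ≥ 1`). -/
abbrev Idx (n : ℕ) := (Fin n × Fin n × ℤ) ⊕ (Fin n × ℕ+)

/-- The Fock space `ℂ[x] ⊗ ℂ[y]`, realized as a polynomial ring in both families of
variables. -/
abbrev PXY (n : ℕ) := MvPolynomial (Idx n) ℂ

/-- The oscillator operator `a_{ij,m} ⊗ 1`. -/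
noncomputable def aOp (n r : ℕ) (i j : Fin n) (m : ℤ) : Module.End ℂ (PXY n) :=
  if 0 ≤ m ∧ (j : ℕ) + 1 ≤ r then (pderiv (Sum.inl (i, j, m))).toLinearMap
  else LinearMap.mulLeft ℂ (X (Sum.inl (i, j, m)))

/-- The oscillator operator `a*_{ij,m} ⊗ 1`. -/
noncomputable def aStar (n r : ℕ) (i j : Fin n) (m : ℤ) : Module.End ℂ (PXY n) :=
  if m ≤ 0 ∧ (j : ℕ) + 1 ≤ r then LinearMap.mulLeft ℂ (X (Sum.inl (i, j, -m)))
  else - (pderiv (Sum.inl (i, j, -m))).toLinearMap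

/-- The Heisenberg operator `1 ⊗ b_{i,m}`. -/
noncomputable def bOp (n : ℕ) (e : Fin n → Fin n → ℂ) (lam : Fin n → ℂ)
    (i : Fin n) (m : ℤ) : Module.End ℂ (PXY n) :=
  if hm : 0 < m then
    (m : ℂ) • ∑ k : Fin n, e i k • (pderiv (Sum.inr (k, (⟨m.toNat, by omega⟩ : ℕ+)))).toLinearMap
  else if hm' : m < 0 then
    ∑ k : Fin n, e i k • LinearMap.mulLeft ℂ (X (Sum.inr (k, (⟨(-m).toNat, by omega⟩ : ℕ+))))
  else lam i • (1 : Module.End ℂ (PXY n))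

/-- The normally ordered quadratic operator `N_{kl,m} = Σ_{q∈ℤ} :a_{kl,q} a*_{kl,m-q}:`
(pointwise `finsum`). -/
noncomputable def Nop (n r : ℕ) (k l : Fin n) (m : ℤ) (P : PXY n) : PXY n :=
  ∑ᶠ q : ℤ,
    if 0 ≤ q ∧ (l : ℕ) + 1 ≤ r then aStar n r k l (m - q) (aOp n r k l q P)
    else aOp n r k l q (aStar n r k l (m - q) P)

/-- The operator `ℋ_{i,m} = Σ_{1 ≤ k ≤ l ≤ n} (α_i|α_{kl}) N_{kl,m}`. -/
noncomputable def Hcal (n r : ℕ) (i : Fin n) (m : ℤ) (P : PXY n) : PXY n :=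
  ∑ k : Fin n, ∑ l : Fin n,
    if k ≤ l then (pairRoot n i k l : ℂ) • Nop n r k l m P else 0

/-- The quadratic operator `(a_{kl} a*_{k'l'})_m = Σ_{q∈ℤ} a_{kl,q} a*_{k'l',m-q}`. -/
noncomputable def pairOp (n r : ℕ) (k l k' l' : Fin n) (m : ℤ) (P : PXY n) : PXY n :=
  ∑ᶠ q : ℤ, aOp n r k l q (aStar n r k' l' (m - q) P)

/-- `Σ_{k=1}^{i-1} (a_{k,i-1} a*_{k,i})_m`. -/
noncomputable def sumLow (n r : ℕ) (i : Fin n) (m : ℤ) (P : PXY n) : PXY n :=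
  ∑ k : Fin n, if h : k < i then
    pairOp n r k (⟨(i : ℕ) - 1, by have := i.isLt; omega⟩ : Fin n) k i m P
  else 0

/-- `Σ_{k=i+1}^{n} (a_{i+1,k} a*_{i,k})_m`. -/
noncomputable def sumHigh (n r : ℕ) (i : Fin n) (m : ℤ) (P : PXY n) : PXY n :=
  ∑ k : Fin n, if h : i < k then
    pairOp n r (⟨(i : ℕ) + 1, by have := k.isLt; have := Fin.lt_def.mp h; omega⟩ : Fin n)
      k i k m P
  else 0

/-- `Σ_{j=i+1}^{n} (a_{i,j} a*_{i+1,j})_m`, the quadratic part of `ρ(F_i)_m`. -/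
noncomputable def sumF (n r : ℕ) (i : Fin n) (m : ℤ) (P : PXY n) : PXY n :=
  ∑ j : Fin n, if h : i < j then
    pairOp n r i j (⟨(i : ℕ) + 1, by have := j.isLt; have := Fin.lt_def.mp h; omega⟩ : Fin n)
      j m P
  else 0

/-- `a_{jl,q}` is an annihilation operator iff `q ≥ 0` and `l ≤ r`. -/
def annAFlag (r : ℕ) {n : ℕ} (l : Fin n) (q : ℤ) : Bool :=
  decide (0 ≤ q ∧ (l : ℕ) + 1 ≤ r)

/-- `a*_{jl,q}` is an annihilation operator iff `q > 0` or `l > r`. -/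
def annSFlag (r : ℕ) {n : ℕ} (l : Fin n) (q : ℤ) : Bool :=
  ! decide (q ≤ 0 ∧ (l : ℕ) + 1 ≤ r)

/-- Normally ordered product of three operators (each tagged with its annihilation flag):
annihilation operators are placed to the right of creation operators. -/
noncomputable def nord3 {n : ℕ} (f1 f2 f3 : Module.End ℂ (PXY n) × Bool) :
    Module.End ℂ (PXY n) :=
  (([f1, f2, f3].filter fun p => !p.2).map Prod.fst).prod *
    (([f1, f2, f3].filter fun p => p.2).map Prod.fst).prod

/-- The mode of `:a*_{ii}(z) a_{kl}(z) a*_{kl}(z):` of `z`-degree `-m-1`. -/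
noncomputable def cubic (n r : ℕ) (i k l : Fin n) (m : ℤ) (P : PXY n) : PXY n :=
  ∑ᶠ q : ℤ × ℤ,
    nord3 (aStar n r i i q.1, annSFlag r i q.1)
      (aOp n r k l q.2, annAFlag r l q.2)
      (aStar n r k l (m - q.1 - q.2), annSFlag r l (m - q.1 - q.2)) P

/-- The mode `ρ(E_i)_m`, the coefficient of `z^{-m-1}` in
`E_i(z) = :a*_{ii}(Σ_{k<i} a_{k,i-1}a*_{k,i-1} − Σ_{k≤i} a_{ki}a*_{ki}):
+ Σ_{k>i} a_{i+1,k}a*_{ik} − Σ_{k<i} a_{k,i-1}a*_{ki} − a*_{ii} b_i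
− (δ_{i>r}(r+1) + δ_{i≤r}(i+1) − γ²) ∂a*_{ii}`. -/
noncomputable def rhoE (n r : ℕ) (γ : ℂ) (e : Fin n → Fin n → ℂ) (lam : Fin n → ℂ)
    (i : Fin n) (m : ℤ) (P : PXY n) : PXY n :=
  (∑ k : Fin n, if h : k < i then
      cubic n r i k (⟨(i : ℕ) - 1, by have := i.isLt; omega⟩ : Fin n) m P
    else 0)
  - (∑ k : Fin n, if k ≤ i then cubic n r i k i m P else 0)
  + sumHigh n r i m P
  - sumLow n r i m P
  - (∑ᶠ q : ℤ, aStar n r i i q (bOp n e lam i (m - q) P))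
  - ((if r < (i : ℕ) + 1 then (r : ℂ) + 1 else 0)
      + (if (i : ℕ) + 1 ≤ r then ((i : ℕ) : ℂ) + 2 else 0) - γ ^ 2) •
      ((-(m : ℂ)) • aStar n r i i m P)

/-- The mode `ρ(H_i)_m = ℋ_{i,m} ⊗ 1 + 1 ⊗ b_{i,m}`. -/
noncomputable def rhoH (n r : ℕ) (e : Fin n → Fin n → ℂ) (lam : Fin n → ℂ)
    (i : Fin n) (m : ℤ) (P : PXY n) : PXY n :=
  Hcal n r i m P + bOp n e lam i m P

/-- The mode `ρ(F_i)_m = a_{ii,m} ⊗ 1 + Σ_{j=i+1}^{n} (a_{ij} a*_{i+1,j})_m ⊗ 1`. -/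
noncomputable def rhoF (n r : ℕ) (i : Fin n) (m : ℤ) (P : PXY n) : PXY n :=
  aOp n r i i m P + sumF n r i m P

/-- The index of the variable `x_{kl,q}`. -/
def xIdx {n : ℕ} (k l : Fin n) (q : ℤ) : Idx n := Sum.inl (k, l, q)

/-- The index of the variable `y_{k,m}` (meaningful for `m > 0`). -/
def yIdx {n : ℕ} (k : Fin n) (m : ℤ) : Idx n := Sum.inr (k, m.toNat.toPNat')

theorem xIdx_inj {n : ℕ} {k l k' l' : Fin n} {q q' : ℤ} :
    xIdx k l q = xIdx k' l' q' ↔ k = k' ∧ l = l' ∧ q = q' := by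
  simp [xIdx]

theorem xIdx_ne_yIdx {n : ℕ} (k l k' : Fin n) (q m : ℤ) : xIdx k l q ≠ yIdx k' m := by
  simp [xIdx, yIdx]

theorem yIdx_inj {n : ℕ} {k k' : Fin n} {m m' : ℤ} (hm : 0 < m) (hm' : 0 < m') :
    yIdx k m = yIdx k' m' ↔ k = k' ∧ m = m' := by
  have h1 : 0 < m.toNat := by omega
  have h2 : 0 < m'.toNat := by omega
  simp only [yIdx, Sum.inr.injEq, Prod.mk.injEq, ← PNat.coe_inj, Nat.toPNat'_coe, h1, h2, if_true]
  omega

/-- The operator `∂/∂X_u` as an element of the endomorphism algebra. -/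
noncomputable def annihilator {n : ℕ} (u : Idx n) : Module.End ℂ (PXY n) :=
  (pderiv u).toLinearMap

/-- Multiplication by `X_u` as an element of the endomorphism algebra. -/
noncomputable def creator {n : ℕ} (u : Idx n) : Module.End ℂ (PXY n) :=
  LinearMap.mulLeft ℂ (X u)

theorem commute_annihilator {n : ℕ} (u v : Idx n) : Commute (annihilator u) (annihilator v) := by
  classical
  have h : ⁅(pderiv u : Derivation ℂ (PXY n) (PXY n)),
      (pderiv v : Derivation ℂ (PXY n) (PXY n))⁆ = 0 := by
    apply MvPolynomial.derivation_ext
    intro w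
    simp [Derivation.commutator_apply, pderiv_X, Pi.single_apply, apply_ite (pderiv (R := ℂ) (_ : Idx n))]
  refine LinearMap.ext fun P => ?_
  have := DFunLike.congr_fun h P
  simpa [annihilator, Derivation.commutator_apply, sub_eq_zero] using this

theorem commute_creator {n : ℕ} (u v : Idx n) : Commute (creator u) (creator v) := by
  refine LinearMap.ext fun P => ?_
  simp [creator, mul_left_comm]

theorem annihilator_mul_creator {n : ℕ} (u v : Idx n) :
    annihilator u * creator v = creator v * annihilator u + if u = v then 1 else 0 := by
  refine LinearMap.ext fun P => ?_
  by_cases h : u = v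
  · subst h
    simp [annihilator, creator]
  · simp [annihilator, creator, pderiv_X_of_ne (Ne.symm h), h]

theorem commute_annihilator_creator {n : ℕ} {u v : Idx n} (h : u ≠ v) :
    Commute (annihilator u) (creator v) := by
  classical
  rw [commute_iff_eq, annihilator_mul_creator, if_neg h, add_zero]

section Oscillators

variable {n r : ℕ}

theorem aOp_eq (k l : Fin n) (q : ℤ) : aOp n r k l q =
    if 0 ≤ q ∧ (l : ℕ) + 1 ≤ r then annihilator (xIdx k l q)
    else creator (xIdx k l q) := rfl

theorem aStar_eq (k l : Fin n) (q : ℤ) : aStar n r k l q =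
    if q ≤ 0 ∧ (l : ℕ) + 1 ≤ r then creator (xIdx k l (-q))
    else (-1 : ℂ) • annihilator (xIdx k l (-q)) := by
  rw [aStar]
  split_ifs
  · rfl
  · refine LinearMap.ext fun P => ?_
    simp [annihilator, xIdx]

theorem commute_aOp_aOp (k l k' l' : Fin n) (q q' : ℤ) :
    Commute (aOp n r k l q) (aOp n r k' l' q') := by
  rw [aOp_eq, aOp_eq]
  split_ifs with h h' h'
  · exact commute_annihilator _ _
  · apply commute_annihilator_creator
    rintro h''
    obtain ⟨rfl, rfl, rfl⟩ := xIdx_inj.1 h''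
    exact h' h
  · apply Commute.symm
    apply commute_annihilator_creator
    rintro h''
    obtain ⟨rfl, rfl, rfl⟩ := xIdx_inj.1 h''
    exact h h'
  · exact commute_creator _ _

theorem commute_aStar_aStar (k l k' l' : Fin n) (q q' : ℤ) :
    Commute (aStar n r k l q) (aStar n r k' l' q') := by
  rw [aStar_eq, aStar_eq]
  split_ifs with h h' h'
  · exact commute_creator _ _
  · refine (commute_annihilator_creator fun hh => h' ?_).symm.smul_right _
    simp only [xIdx_inj, neg_inj] at hh
    obtain ⟨rfl, rfl, rfl⟩ := hh
    exact h
  · refine (commute_annihilator_creator fun hh => h ?_).smul_left _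
    simp only [xIdx_inj, neg_inj] at hh
    obtain ⟨rfl, rfl, rfl⟩ := hh
    exact h'
  · exact ((commute_annihilator _ _).smul_left _).smul_right _

theorem aOp_mul_aStar_self (k l : Fin n) (q : ℤ) :
    aOp n r k l q * aStar n r k l (-q) = aStar n r k l (-q) * aOp n r k l q + 1 := by
  rw [aOp_eq, aStar_eq, neg_neg]
  by_cases h : 0 ≤ q ∧ (l : ℕ) + 1 ≤ r
  · rw [if_pos h, if_pos ⟨by omega, h.2⟩, annihilator_mul_creator, if_pos rfl]
  · rw [if_neg h, if_neg (by omega), smul_mul_assoc, mul_smul_comm,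
      annihilator_mul_creator, if_pos rfl, smul_add]
    module

theorem commute_aOp_aStar {k l k' l' : Fin n} {q q' : ℤ} (h : ¬ (k = k' ∧ l = l' ∧ q + q' = 0)) :
    Commute (aOp n r k l q) (aStar n r k' l' q') := by
  have hne : xIdx k l q ≠ xIdx k' l' (-q') := by
    simp only [ne_eq, xIdx_inj]
    rintro ⟨rfl, rfl, rfl⟩
    exact h ⟨rfl, rfl, by omega⟩
  rw [aOp_eq, aStar_eq]
  split_ifs with h1 h2 h2
  · exact commute_annihilator_creator hne
  · exact (commute_annihilator _ _).smul_right _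
  · exact commute_creator _ _
  · exact (commute_annihilator_creator hne.symm).symm.smul_right _

theorem aOp_mul_aStar (k l k' l' : Fin n) (q q' : ℤ) :
    aOp n r k l q * aStar n r k' l' q' =
      aStar n r k' l' q' * aOp n r k l q + if k = k' ∧ l = l' ∧ q + q' = 0 then 1 else 0 := by
  split_ifs with h
  · obtain ⟨rfl, rfl, h⟩ := h
    obtain rfl : q' = -q := by omega
    exact aOp_mul_aStar_self k l q
  · rw [add_zero, (commute_aOp_aStar h).eq]

variable {e : Fin n → Fin n → ℂ} {lam : Fin n → ℂ}

theorem bOp_eq_of_pos (i : Fin n) {m : ℤ} (hm : 0 < m) : bOp n e lam i m =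
    (m : ℂ) • ∑ k : Fin n, e i k • annihilator (yIdx k m) := by
  have h (h0) : (⟨m.toNat, h0⟩ : ℕ+) = m.toNat.toPNat' := PNat.eq (by simp [Nat.toPNat'_coe, hm])
  rw [bOp, dif_pos hm]
  simp only [h]
  rfl

theorem bOp_eq_of_neg (i : Fin n) {m : ℤ} (hm : m < 0) : bOp n e lam i m =
    ∑ k : Fin n, e i k • creator (yIdx k (-m)) := by
  have h (h0) : (⟨(-m).toNat, h0⟩ : ℕ+) = (-m).toNat.toPNat' :=
    PNat.eq (by simp [Nat.toPNat'_coe, hm])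
  rw [bOp, dif_neg hm.not_gt, dif_pos hm]
  simp only [h]
  rfl

theorem bOp_zero (i : Fin n) : bOp n e lam i 0 = lam i • 1 := by
  rw [bOp, dif_neg (lt_irrefl _), dif_neg (lt_irrefl _)]

theorem commute_bOp_of_commute {T : Module.End ℂ (PXY n)}
    (hp : ∀ k m, Commute (annihilator (yIdx k m)) T)
    (hX : ∀ k m, Commute (creator (yIdx k m)) T)
    (i : Fin n) (m : ℤ) : Commute (bOp n e lam i m) T := by
  rcases lt_trichotomy 0 m with hm | rfl | hm
  · rw [bOp_eq_of_pos i hm]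
    exact (Commute.sum_left _ _ _ fun k _ => (hp _ _).smul_left _).smul_left _
  · rw [bOp_zero]
    exact (Commute.one_left _).smul_left _
  · rw [bOp_eq_of_neg i hm]
    exact Commute.sum_left _ _ _ fun k _ => (hX _ _).smul_left _

theorem commute_bOp_aOp (i k l : Fin n) (m q : ℤ) :
    Commute (bOp n e lam i m) (aOp n r k l q) := by
  apply commute_bOp_of_commute <;> intro _ _ <;> rw [aOp_eq] <;> split_ifs
  · exact commute_annihilator _ _
  · exact commute_annihilator_creator (xIdx_ne_yIdx _ _ _ _ _).symm
  · exact (commute_annihilator_creator (xIdx_ne_yIdx _ _ _ _ _)).symm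
  · exact commute_creator _ _

theorem commute_bOp_aStar (i k l : Fin n) (m q : ℤ) :
    Commute (bOp n e lam i m) (aStar n r k l q) := by
  apply commute_bOp_of_commute <;> intro _ _ <;> rw [aStar_eq] <;> split_ifs
  · exact commute_annihilator_creator (xIdx_ne_yIdx _ _ _ _ _).symm
  · exact (commute_annihilator _ _).smul_right _
  · exact commute_creator _ _
  · exact (commute_annihilator_creator (xIdx_ne_yIdx _ _ _ _ _)).symm.smul_right _

theorem bOp_mul_bOp_neg (i j : Fin n) {m : ℤ} (hm : 0 < m) :
    bOp n e lam i m * bOp n e lam j (-m) =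
      bOp n e lam j (-m) * bOp n e lam i m + ((m : ℂ) * ∑ k, e i k * e j k) • 1 := by
  have h (k k' : Fin n) : yIdx k m = yIdx k' (- -m) ↔ k = k' := by
    rw [neg_neg, yIdx_inj hm hm, and_iff_left rfl]
  rw [bOp_eq_of_pos i hm, bOp_eq_of_neg j (by omega : -m < 0)]
  simp only [smul_mul_assoc, mul_smul_comm, Finset.sum_mul, Finset.mul_sum,
    annihilator_mul_creator, h, smul_add, Finset.sum_add_distrib, Finset.smul_sum]
  rw [Finset.sum_comm]
  congr 1
  · apply Finset.sum_congr rfl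
    intro k _
    apply Finset.sum_congr rfl
    intro k' _
    module
  · rw [Finset.sum_smul]
    apply Finset.sum_congr rfl
    intro k _
    rw [Finset.sum_eq_single k]
    · rw [if_pos rfl]
      module
    · intro k' _ hk
      rw [if_neg hk]
      simp only [smul_zero]
    · exact fun hk => absurd (Finset.mem_univ k) hk

theorem commute_bOp_bOp_of_pos (i j : Fin n) {m p : ℤ} (hm : 0 < m) (h : m + p ≠ 0) :
    Commute (bOp n e lam i m) (bOp n e lam j p) := by
  rcases lt_trichotomy 0 p with hp | rfl | hp
  · rw [bOp_eq_of_pos i hm, bOp_eq_of_pos j hp]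
    exact ((Commute.sum_left _ _ _ fun k _ => Commute.sum_right _ _ _ fun k' _ =>
      ((commute_annihilator _ _).smul_left _).smul_right _).smul_left _).smul_right _
  · rw [bOp_zero]
    exact (Commute.one_right _).smul_right _
  · rw [bOp_eq_of_pos i hm, bOp_eq_of_neg j hp]
    refine (Commute.sum_left _ _ _ fun k _ => Commute.sum_right _ _ _ fun k' _ =>
      ((commute_annihilator_creator ?_).smul_left _).smul_right _).smul_left _
    rw [Ne, yIdx_inj (by omega) (by omega)]
    omega

theorem commute_bOp_bOp (i j : Fin n) {m p : ℤ} (h : m + p ≠ 0) :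
    Commute (bOp n e lam i m) (bOp n e lam j p) := by
  by_cases hm : 0 < m
  · exact commute_bOp_bOp_of_pos i j hm h
  by_cases hp : 0 < p
  · exact (commute_bOp_bOp_of_pos j i hp (by omega)).symm
  rcases (not_lt.1 hm).eq_or_lt with rfl | hm
  · rw [bOp_zero]
    exact (Commute.one_left _).smul_left _
  rcases (not_lt.1 hp).eq_or_lt with rfl | hp
  · rw [bOp_zero]
    exact (Commute.one_right _).smul_right _
  rw [bOp_eq_of_neg i hm, bOp_eq_of_neg j hp]
  exact Commute.sum_left _ _ _ fun k _ => Commute.sum_right _ _ _ fun k' _ =>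
    ((commute_creator _ _).smul_left _).smul_right _

theorem bOp_mul_bOp (i j : Fin n) (m p : ℤ) :
    bOp n e lam i m * bOp n e lam j p = bOp n e lam j p * bOp n e lam i m +
      if m + p = 0 then ((m : ℂ) * ∑ k, e i k * e j k) • 1 else 0 := by
  by_cases h : m + p = 0
  · rw [if_pos h]
    rcases lt_trichotomy 0 m with hm | rfl | hm
    · obtain rfl : p = -m := by omega
      rw [bOp_mul_bOp_neg i j hm]
    · rw [bOp_zero, Int.cast_zero, zero_mul, zero_smul, add_zero]
      exact (Commute.one_left _).smul_left _
    · obtain rfl : m = -p := by omega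
      rw [bOp_mul_bOp_neg j i (by omega : 0 < p), add_assoc]
      simp only [mul_comm (e i _), Int.cast_neg]
      module
  · rw [if_neg h, add_zero, (commute_bOp_bOp i j h).eq]

/-- The absolute value of the mode of a variable. -/
def modeSize : Idx n → ℤ := Sum.elim (fun v => |v.2.2|) (fun v => ((v.2 : ℕ) : ℤ))

theorem exists_annihilator_bound (P : PXY n) : ∃ B : ℤ, 0 ≤ B ∧
    ∀ u : Idx n, B < modeSize u → annihilator u P = 0 := by
  have hnn : ∀ u : Idx n, 0 ≤ modeSize u := by
    rintro (u | u) <;> simp [modeSize]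
  refine ⟨∑ u ∈ P.vars, modeSize u, Finset.sum_nonneg fun u _ => hnn u, fun u hu => ?_⟩
  refine pderiv_eq_zero_of_notMem_vars fun h => hu.not_ge ?_
  exact Finset.single_le_sum (fun v _ => hnn v) h

/-- Modes beyond a bound depending on `P` that act as derivatives annihilate `P`. -/
theorem exists_mode_bound (r : ℕ) (e : Fin n → Fin n → ℂ) (lam : Fin n → ℂ) (P : PXY n) :
    ∃ B : ℤ, 0 ≤ B ∧
    (∀ k l : Fin n, ∀ q : ℤ, B < q → (l : ℕ) + 1 ≤ r → aOp n r k l q P = 0) ∧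
    (∀ k l : Fin n, ∀ q : ℤ, B < q → aStar n r k l q P = 0) ∧
    (∀ k l : Fin n, ∀ q : ℤ, q < -B → ¬ (l : ℕ) + 1 ≤ r → aStar n r k l q P = 0) ∧
    (∀ i : Fin n, ∀ q : ℤ, B < q → bOp n e lam i q P = 0) := by
  obtain ⟨B, hB, h⟩ := exists_annihilator_bound P
  refine ⟨B, hB, fun k l q hq hl => ?_, fun k l q hq => ?_, fun k l q hq hl => ?_,
    fun i q hq => ?_⟩
  · rw [aOp_eq, if_pos ⟨by omega, hl⟩]
    exact h _ (hq.trans_le (le_abs_self _))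
  · rw [aStar_eq, if_neg (by omega), LinearMap.smul_apply]
    rw [h (xIdx k l (-q)) (hq.trans_le ((le_abs_self q).trans_eq (abs_neg q).symm)), smul_zero]
  · rw [aStar_eq, if_neg (by omega), LinearMap.smul_apply]
    rw [h _ ((by omega : B < -q).trans_le (le_abs_self _)), smul_zero]
  · rw [bOp_eq_of_pos i (by omega)]
    simp only [LinearMap.smul_apply, LinearMap.sum_apply]
    rw [Finset.sum_eq_zero fun k _ => ?_, smul_zero]
    rw [h, smul_zero]
    simp only [modeSize, yIdx, Sum.elim_inr, Nat.toPNat'_coe]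
    split_ifs <;> omega

end Oscillators

section PointwiseFinite

variable {ι V : Type*} [AddCommGroup V] [Module ℂ V]

/-- A family of operators only finitely many of which are nonzero on any given vector. -/
def PointwiseFinite (F : ι → Module.End ℂ V) : Prop :=
  ∀ P, (fun q => F q P).HasFiniteSupport

/-- The sum of a pointwise finite family of operators. -/
noncomputable def PointwiseFinite.sum {F : ι → Module.End ℂ V} (hF : PointwiseFinite F) :
    Module.End ℂ V where
  toFun P := ∑ᶠ q, F q P
  map_add' P Q := by simp only [map_add, finsum_add_distrib (hF P) (hF Q)]
  map_smul' c P := by simp only [map_smul, RingHom.id_apply, smul_finsum' c (hF P)]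

theorem PointwiseFinite.of_finset {F : ι → Module.End ℂ V}
    (h : ∀ P, ∃ s : Finset ι, ∀ q, F q P ≠ 0 → q ∈ s) : PointwiseFinite F := fun P => by
  obtain ⟨s, hs⟩ := h P
  exact s.finite_toSet.subset fun q hq => hs q hq

theorem PointwiseFinite.comp_equiv {F : ι → Module.End ℂ V} (hF : PointwiseFinite F)
    (f : ι ≃ ι) : PointwiseFinite fun q => F (f q) := fun P =>
  (hF P).preimage f.injective.injOn

theorem map_finsum_of_mul_eq {F G : ι → Module.End ℂ V} (hF : PointwiseFinite F)
    {D : Module.End ℂ V} (h : ∀ q, D * F q = F q * D + G q) (P : V) :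
    D (∑ᶠ q, F q P) = ∑ᶠ q, F q (D P) + ∑ᶠ q, G q P := by
  have h' (q) : D (F q P) = F q (D P) + G q P := LinearMap.congr_fun (h q) P
  have hD : (fun q => D (F q P)).HasFiniteSupport := (hF P).subset fun q hq hq' => hq (by
    simp only at hq' ⊢
    rw [hq', map_zero])
  have hG : (fun q => G q P).HasFiniteSupport :=
    (hD.union (hF (D P))).subset fun q hq => by
      by_contra hc
      simp only [Set.mem_union, Function.mem_support, not_or, not_not] at hc
      exact hq (by simpa [hc.1, hc.2] using (h' q).symm)
  rw [map_finsum D (hF P), ← finsum_add_distrib (hF (D P)) hG]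
  exact finsum_congr h'

theorem hasFiniteSupport_graph {f : ℤ → ℂ} (hf : f.HasFiniteSupport) (g : ℤ → ℤ) (v : V) :
    (fun q : ℤ × ℤ => f q.2 • if q.1 = g q.2 then v else 0).HasFiniteSupport := by
  refine (hf.image fun q => (g q, q)).subset fun q hq => ?_
  simp only [Function.mem_support, ne_eq, smul_eq_zero, not_or, ite_eq_right_iff,
    Classical.not_imp] at hq
  exact ⟨q.2, hq.1, Prod.ext hq.2.1.symm rfl⟩

theorem finsum_graph {f : ℤ → ℂ} (hf : f.HasFiniteSupport) (g : ℤ → ℤ) (v : V) :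
    ∑ᶠ q : ℤ × ℤ, (f q.2 • if q.1 = g q.2 then v else 0) = (∑ᶠ q, f q) • v := by
  have hinj : Function.Injective fun q => (g q, q) := fun a b h => (Prod.mk.inj h).2
  have hf' : (Function.support f).Finite := hf
  rw [finsum_eq_sum_of_support_subset (s := hf'.toFinset.image fun q => (g q, q)),
    finsum_eq_sum_of_support_subset (s := hf'.toFinset), Finset.sum_image hinj.injOn,
    Finset.sum_smul]
  · simp
  · simp
  · intro q hq
    simp only [Function.mem_support, ne_eq, smul_eq_zero, not_or, ite_eq_right_iff,
      Classical.not_imp] at hq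
    simp only [Finset.coe_image, Set.Finite.coe_toFinset]
    exact ⟨q.2, hq.1, Prod.ext hq.2.1.symm rfl⟩

end PointwiseFinite

theorem hasFiniteSupport_indicator_sub_shift (m : ℤ) :
    (fun q : ℤ => (if 0 ≤ q then 1 else 0 : ℂ) - if 0 ≤ q + m then 1 else 0).HasFiniteSupport := by
  refine (Finset.Icc (-|m|) |m|).finite_toSet.subset fun q hq => ?_
  rw [Function.mem_support] at hq
  have := le_abs_self m
  have := neg_abs_le m
  rw [Finset.coe_Icc, Set.mem_Icc]
  split_ifs at hq
  · simp at hq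
  · omega
  · omega
  · simp at hq

theorem finsum_indicator_sub_shift (m : ℤ) :
    ∑ᶠ q : ℤ, ((if 0 ≤ q then 1 else 0 : ℂ) - if 0 ≤ q + m then 1 else 0) = -m := by
  rcases le_total 0 m with hm | hm
  · have h (q : ℤ) : ((if 0 ≤ q then 1 else 0 : ℂ) - if 0 ≤ q + m then 1 else 0) =
        if q ∈ Finset.Ico (-m) 0 then -1 else 0 := by
      simp only [Finset.mem_Ico]
      split_ifs <;> first | omega | simp
    rw [finsum_congr h, finsum_eq_sum_of_support_subset (s := Finset.Ico (-m) 0),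
      Finset.sum_congr rfl fun q hq => if_pos hq]
    · simp only [Finset.sum_const, Int.card_Ico, zero_sub, neg_neg, nsmul_eq_mul, mul_neg, mul_one]
      rw [← Int.cast_natCast, Int.toNat_of_nonneg hm]
    · intro q hq
      by_contra hc
      exact hq (if_neg hc)
  · have h (q : ℤ) : ((if 0 ≤ q then 1 else 0 : ℂ) - if 0 ≤ q + m then 1 else 0) =
        if q ∈ Finset.Ico 0 (-m) then 1 else 0 := by
      simp only [Finset.mem_Ico]
      split_ifs <;> first | omega | simp
    rw [finsum_congr h, finsum_eq_sum_of_support_subset (s := Finset.Ico 0 (-m)),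
      Finset.sum_congr rfl fun q hq => if_pos hq]
    · simp only [Finset.sum_const, Int.card_Ico, sub_zero, nsmul_eq_mul, mul_one]
      rw [← Int.cast_natCast, Int.toNat_of_nonneg (by omega), Int.cast_neg]
    · intro q hq
      by_contra hc
      exact hq (if_neg hc)

section NormalOrdering

variable {n : ℕ} (r : ℕ)

/-- The normally ordered product `:a_{kl,q} a*_{kl,s}:`. -/
noncomputable def quadProd (k l : Fin n) (q s : ℤ) : Module.End ℂ (PXY n) :=
  if 0 ≤ q ∧ (l : ℕ) + 1 ≤ r then aStar n r k l s * aOp n r k l q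
  else aOp n r k l q * aStar n r k l s

/-- The normally ordered product `:a*_{ii,t} a_{kl,q} a*_{kl,s}:`. -/
noncomputable def cubicProd (i k l : Fin n) (t q s : ℤ) : Module.End ℂ (PXY n) :=
  if 0 ≤ q ∧ (l : ℕ) + 1 ≤ r then aStar n r i i t * aStar n r k l s * aOp n r k l q
  else aOp n r k l q * (aStar n r i i t * aStar n r k l s)

variable {r}

theorem Nop_eq_finsum (k l : Fin n) (m : ℤ) (P : PXY n) :
    Nop n r k l m P = ∑ᶠ q : ℤ, quadProd r k l q (m - q) P := by
  refine finsum_congr fun q => ?_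
  rw [quadProd]
  split_ifs <;> rfl

theorem nord3_eq_cubicProd (i k l : Fin n) (t q s : ℤ) :
    nord3 (aStar n r i i t, annSFlag r i t) (aOp n r k l q, annAFlag r l q)
      (aStar n r k l s, annSFlag r l s) = cubicProd r i k l t q s := by
  have hss := (commute_aStar_aStar (r := r) i i k l t s).eq
  rw [nord3, cubicProd]
  by_cases hq : 0 ≤ q ∧ (l : ℕ) + 1 ≤ r
  · have has (k' l' : Fin n) (t' : ℤ) (h : annSFlag r l' t' = true) :
        aOp n r k l q * aStar n r k' l' t' = aStar n r k' l' t' * aOp n r k l q := by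
      refine (commute_aOp_aStar ?_).eq
      rintro ⟨rfl, rfl, h0⟩
      simp only [annSFlag, Bool.not_eq_true', decide_eq_false_iff_not] at h
      omega
    have h2 : annAFlag r l q = true := by simpa [annAFlag] using hq
    rw [if_pos hq, h2]
    rcases h1 : annSFlag r i t <;> rcases h3 : annSFlag r l s <;>
      simp only [List.filter, Bool.not_true, Bool.not_false, List.map, List.prod_cons,
        List.prod_nil, mul_one, one_mul, mul_assoc]
    · rw [has k l s h3]
    · rw [← mul_assoc, ← hss, mul_assoc]
    · rw [has k l s h3]
  · have h2 : annAFlag r l q = false := by simpa [annAFlag] using hq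
    have has (k' l' : Fin n) (t' : ℤ) (h : annSFlag r l' t' = false) :
        aOp n r k l q * aStar n r k' l' t' = aStar n r k' l' t' * aOp n r k l q := by
      refine (commute_aOp_aStar ?_).eq
      rintro ⟨rfl, rfl, h0⟩
      simp only [annSFlag, Bool.not_eq_false', decide_eq_true_eq] at h
      omega
    rw [if_neg hq, h2]
    rcases h1 : annSFlag r i t <;> rcases h3 : annSFlag r l s <;>
      simp only [List.filter, Bool.not_true, Bool.not_false, List.map, List.prod_cons,
        List.prod_nil, mul_one, mul_assoc]
    · rw [← mul_assoc, ← has i i t h1, mul_assoc]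
    · rw [← mul_assoc, ← has i i t h1, mul_assoc]
    · rw [hss]

theorem cubic_eq_finsum (i k l : Fin n) (m : ℤ) (P : PXY n) :
    cubic n r i k l m P =
      ∑ᶠ q : ℤ × ℤ, cubicProd r i k l q.1 q.2 (m - q.1 - q.2) P :=
  finsum_congr fun q => by rw [nord3_eq_cubicProd]

theorem pointwiseFinite_quadProd (k l : Fin n) (m : ℤ) :
    PointwiseFinite fun q : ℤ => quadProd r k l q (m - q) := by
  refine PointwiseFinite.of_finset fun P => ?_
  obtain ⟨B, hB, hA, hS, hS', -⟩ := exists_mode_bound r 0 0 P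
  refine ⟨Finset.Icc (-(B + |m|)) (B + |m|), fun q hq => ?_⟩
  have h1 := le_abs_self m
  have h2 := neg_abs_le m
  rw [Finset.mem_Icc]
  by_contra hc
  apply hq
  rw [quadProd]
  split_ifs with hl
  · by_cases hqB : B < q
    · simp only [Module.End.mul_apply, hA k l q hqB hl.2, map_zero]
    · omega
  · have : aStar n r k l (m - q) P = 0 := by
      by_cases hqB : B < m - q
      · exact hS k l _ hqB
      · exact hS' k l _ (by omega) (by omega)
    simp only [Module.End.mul_apply, this, map_zero]

theorem pointwiseFinite_cubicProd {i k l : Fin n} (hil : (i : ℕ) + 1 ≤ r → (l : ℕ) + 1 ≤ r)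
    (m : ℤ) : PointwiseFinite fun q : ℤ × ℤ => cubicProd r i k l q.1 q.2 (m - q.1 - q.2) := by
  refine PointwiseFinite.of_finset fun P => ?_
  obtain ⟨B, hB, hA, hS, hS', -⟩ := exists_mode_bound r 0 0 P
  refine ⟨Finset.Icc (-(2 * B + |m|)) (2 * B + |m|) ×ˢ Finset.Icc (-(2 * B + |m|)) (2 * B + |m|),
    fun ⟨t, q⟩ hq => ?_⟩
  have h1 := le_abs_self m
  have h2 := neg_abs_le m
  simp only at hq
  generalize hs : m - t - q = s at hq
  have hss := (commute_aStar_aStar (r := r) i i k l t s).eq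
  have ht0 (h : aStar n r i i t P = 0) (h' : l = i → q + t ≠ 0 ∨ ¬ (0 ≤ q ∧ (l : ℕ) + 1 ≤ r)) :
      cubicProd r i k l t q s P = 0 := by
    rw [cubicProd]
    split_ifs with hl
    · rw [hss, mul_assoc, ← (commute_aOp_aStar _).eq]
      · simp only [Module.End.mul_apply, h, map_zero]
      · rintro ⟨rfl, rfl, h0⟩
        tauto
    · rw [hss]
      simp only [Module.End.mul_apply, h, map_zero]
  have hs0 (h : aStar n r k l s P = 0) (h' : q + s ≠ 0 ∨ ¬ (0 ≤ q ∧ (l : ℕ) + 1 ≤ r)) :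
      cubicProd r i k l t q s P = 0 := by
    rw [cubicProd]
    split_ifs with hl
    · rw [mul_assoc, ← (commute_aOp_aStar (by tauto)).eq]
      simp only [Module.End.mul_apply, h, map_zero]
    · simp only [Module.End.mul_apply, h, map_zero]
  have hq0 (h : aOp n r k l q P = 0) (h' : 0 ≤ q ∧ (l : ℕ) + 1 ≤ r) :
      cubicProd r i k l t q s P = 0 := by
    rw [cubicProd, if_pos h']
    simp only [Module.End.mul_apply, h, map_zero]
  have htB : t ≤ B := by
    by_contra hc
    exact hq (ht0 (hS i i t (by omega)) fun _ => by omega)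
  have hsB : s ≤ B := by
    by_contra hc
    exact hq (hs0 (hS k l s (by omega)) (by omega))
  rw [Finset.mem_product, Finset.mem_Icc, Finset.mem_Icc]
  by_cases hl : (l : ℕ) + 1 ≤ r
  · have hqB : q ≤ B := by
      by_contra hc
      exact hq (hq0 (hA k l q (by omega) hl) (by omega))
    omega
  · have htB' : -B ≤ t := by
      by_contra hc
      exact hq (ht0 (hS' i i t (by omega) (by omega)) fun _ => by omega)
    have hsB' : -B ≤ s := by
      by_contra hc
      exact hq (hs0 (hS' k l s (by omega) hl) (by omega))
    omega

theorem pointwiseFinite_aOp_mul_aStar {k l k' l' : Fin n}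
    (hkl : ¬ (k = k' ∧ l = l')) (hl : (l' : ℕ) + 1 ≤ r → (l : ℕ) + 1 ≤ r) (m : ℤ) :
    PointwiseFinite fun q : ℤ => aOp n r k l q * aStar n r k' l' (m - q) := by
  refine PointwiseFinite.of_finset fun P => ?_
  obtain ⟨B, hB, hA, hS, hS', -⟩ := exists_mode_bound r 0 0 P
  refine ⟨Finset.Icc (-(B + |m|)) (B + |m|), fun q hq => ?_⟩
  have h1 := le_abs_self m
  have h2 := neg_abs_le m
  rw [Finset.mem_Icc]
  by_contra hc
  apply hq
  by_cases hs : B < m - q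
  · simp only [Module.End.mul_apply, hS k' l' _ hs, map_zero]
  by_cases hl' : (l' : ℕ) + 1 ≤ r
  · rw [(commute_aOp_aStar (by tauto)).eq, Module.End.mul_apply, hA k l q (by omega) (hl hl'),
      map_zero]
  · simp only [Module.End.mul_apply, hS' k' l' (m - q) (by omega) hl', map_zero]

theorem pointwiseFinite_aStar_mul_bOp (e : Fin n → Fin n → ℂ) (lam : Fin n → ℂ)
    (i k l : Fin n) (m : ℤ) :
    PointwiseFinite fun q : ℤ => aStar n r k l q * bOp n e lam i (m - q) := by
  refine PointwiseFinite.of_finset fun P => ?_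
  obtain ⟨B, hB, -, hS, -, hb⟩ := exists_mode_bound r e lam P
  refine ⟨Finset.Icc (-(B + |m|)) (B + |m|), fun q hq => ?_⟩
  have h1 := le_abs_self m
  have h2 := neg_abs_le m
  rw [Finset.mem_Icc]
  by_contra hc
  apply hq
  by_cases hs : B < m - q
  · simp only [Module.End.mul_apply, hb i _ hs, map_zero]
  · rw [← (commute_bOp_aStar i k l _ _).eq, Module.End.mul_apply, hS k l q (by omega), map_zero]

end NormalOrdering

section FinsumShift

variable {ι V : Type*} [AddCommGroup V] [Module ℂ V]

theorem PointwiseFinite.finsum_comp_equiv {F : ι → Module.End ℂ V} (f : ι ≃ ι) (P : V) :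
    ∑ᶠ q, F (f q) P = ∑ᶠ q, F q P :=
  _root_.finsum_comp_equiv (f := fun q => F q P) f

theorem PointwiseFinite.smul {F : ι → Module.End ℂ V} (hF : PointwiseFinite F) (c : ℂ) :
    PointwiseFinite fun q => c • F q := fun P =>
  (hF P).subset fun q hq hq' => hq (by
    simp only at hq' ⊢
    rw [LinearMap.smul_apply, hq', smul_zero])

theorem PointwiseFinite.add {F G : ι → Module.End ℂ V} (hF : PointwiseFinite F)
    (hG : PointwiseFinite G) : PointwiseFinite fun q => F q + G q := fun P =>
  ((hF P).union (hG P)).subset fun q hq => by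
    by_contra hc
    simp only [Set.mem_union, Function.mem_support, not_or, not_not] at hc
    exact hq (by simp only [LinearMap.add_apply, hc.1, hc.2, add_zero])

theorem finsum_add_apply {F G : ι → Module.End ℂ V} (hF : PointwiseFinite F)
    (hG : PointwiseFinite G) (P : V) :
    ∑ᶠ q, (F q + G q) P = ∑ᶠ q, F q P + ∑ᶠ q, G q P :=
  finsum_add_distrib (hF P) (hG P)

theorem finsum_smul_apply {F : ι → Module.End ℂ V} (hF : PointwiseFinite F) (c : ℂ) (P : V) :
    ∑ᶠ q, (c • F q) P = c • ∑ᶠ q, F q P :=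
  (smul_finsum' c (hF P)).symm

end FinsumShift

section CartanMode

variable {n r : ℕ} {e : Fin n → Fin n → ℂ} {lam : Fin n → ℂ}

theorem mul_quadProd {T : Module.End ℂ (PXY n)} {k l : Fin n} {q s : ℤ} {α β : ℂ}
    (hA : T * aOp n r k l q = aOp n r k l q * T + α • 1)
    (hS : T * aStar n r k l s = aStar n r k l s * T + β • 1) :
    T * quadProd r k l q s =
      quadProd r k l q s * T + (α • aStar n r k l s + β • aOp n r k l q) := by
  rw [quadProd]
  split_ifs
  · rw [← mul_assoc, hS, add_mul, mul_assoc, hA, mul_add, mul_assoc, smul_mul_assoc, one_mul,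
      mul_smul_comm, mul_one]
    module
  · rw [← mul_assoc, hA, add_mul, mul_assoc, hS, mul_add, mul_assoc, smul_mul_assoc, one_mul,
      mul_smul_comm, mul_one]
    module

/-- `N_{kl,m}` as a linear operator. -/
noncomputable def NopLin (r : ℕ) (k l : Fin n) (m : ℤ) : Module.End ℂ (PXY n) :=
  (pointwiseFinite_quadProd (r := r) k l m).sum

theorem NopLin_apply (k l : Fin n) (m : ℤ) (P : PXY n) :
    NopLin r k l m P = Nop n r k l m P :=
  (Nop_eq_finsum k l m P).symm

theorem NopLin_mul_of_mul_quadProd {T V : Module.End ℂ (PXY n)}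
    {G : ℤ → Module.End ℂ (PXY n)} {k l : Fin n} {m : ℤ}
    (h : ∀ q, T * quadProd r k l q (m - q) = quadProd r k l q (m - q) * T + G q)
    (hV : ∀ P, ∑ᶠ q, G q P = (-1 : ℂ) • V P) :
    NopLin r k l m * T = T * NopLin r k l m + V := by
  refine LinearMap.ext fun P => ?_
  have := map_finsum_of_mul_eq (pointwiseFinite_quadProd k l m) h P
  rw [hV] at this
  rw [LinearMap.add_apply, Module.End.mul_apply, Module.End.mul_apply]
  change ∑ᶠ q, quadProd r k l q (m - q) (T P) = T (∑ᶠ q, quadProd r k l q (m - q) P) + V P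
  rw [this]
  module

theorem NopLin_mul_aStar (k l k' l' : Fin n) (m p : ℤ) :
    NopLin r k l m * aStar n r k' l' p = aStar n r k' l' p * NopLin r k l m +
      if k = k' ∧ l = l' then aStar n r k' l' (p + m) else 0 := by
  refine NopLin_mul_of_mul_quadProd (G := fun q =>
    (if k = k' ∧ l = l' ∧ q + p = 0 then -1 else 0 : ℂ) • aStar n r k l (m - q) +
      (0 : ℂ) • aOp n r k l q) (fun q => mul_quadProd ?_ ?_) fun P => ?_
  · rw [aOp_mul_aStar]
    split_ifs <;> module
  · rw [(commute_aStar_aStar _ _ _ _ _ _).eq]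
    module
  · rw [finsum_eq_single _ (-p) fun q hq => ?_]
    · simp only [neg_add_cancel, and_true]
      split_ifs with h
      · obtain ⟨rfl, rfl⟩ := h
        rw [sub_neg_eq_add, add_comm m p, zero_smul, add_zero]
        rfl
      · rw [zero_smul, zero_smul, add_zero, LinearMap.zero_apply, smul_zero]
    · rw [if_neg (by omega), zero_smul, zero_smul, add_zero, LinearMap.zero_apply]

theorem NopLin_mul_aOp (k l k' l' : Fin n) (m p : ℤ) :
    NopLin r k l m * aOp n r k' l' p = aOp n r k' l' p * NopLin r k l m +
      if k = k' ∧ l = l' then (-1 : ℂ) • aOp n r k' l' (p + m) else 0 := by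
  refine NopLin_mul_of_mul_quadProd (G := fun q => (0 : ℂ) • aStar n r k l (m - q) +
    (if k' = k ∧ l' = l ∧ p + (m - q) = 0 then 1 else 0 : ℂ) • aOp n r k l q)
    (fun q => mul_quadProd ?_ ?_) fun P => ?_
  · rw [(commute_aOp_aOp _ _ _ _ _ _).eq]
    module
  · rw [aOp_mul_aStar]
    split_ifs <;> module
  · rw [finsum_eq_single _ (p + m) fun q hq => ?_]
    · have h0 : p + (m - (p + m)) = 0 := by omega
      simp only [h0, and_true, eq_comm (a := k'), eq_comm (a := l')]
      split_ifs with h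
      · obtain ⟨rfl, rfl⟩ := h
        simp only [LinearMap.add_apply, LinearMap.smul_apply]
        module
      · rw [zero_smul, zero_smul, add_zero, LinearMap.zero_apply, smul_zero]
    · rw [if_neg (by omega), zero_smul, zero_smul, add_zero, LinearMap.zero_apply]

theorem NopLin_mul_bOp (k l j : Fin n) (m p : ℤ) :
    NopLin r k l m * bOp n e lam j p = bOp n e lam j p * NopLin r k l m := by
  rw [NopLin_mul_of_mul_quadProd (V := 0) (G := fun q => (0 : ℂ) • aStar n r k l (m - q) +
    (0 : ℂ) • aOp n r k l q) (fun q => mul_quadProd ?_ ?_) fun P => ?_, add_zero]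
  · rw [(commute_bOp_aOp _ _ _ _ _).eq]
    module
  · rw [(commute_bOp_aStar _ _ _ _ _).eq]
    module
  · simp only [zero_smul, add_zero, LinearMap.zero_apply, smul_zero, finsum_zero]

/-- The operator `D` has the commutation relations with the oscillators of the `m`-th mode of
a Cartan current for which `a*_{kl}` has weight `w k l`. -/
structure IsCartanMode (r : ℕ) (w : Fin n → Fin n → ℂ) (m : ℤ)
    (D : Module.End ℂ (PXY n)) : Prop where
  mul_aOp : ∀ {k l : Fin n}, k ≤ l → ∀ q : ℤ,
    D * aOp n r k l q = aOp n r k l q * D + (-w k l) • aOp n r k l (q + m)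
  mul_aStar : ∀ {k l : Fin n}, k ≤ l → ∀ q : ℤ,
    D * aStar n r k l q = aStar n r k l q * D + w k l • aStar n r k l (q + m)

/-- `ρ(H_i)_m` as a linear operator. -/
noncomputable def rhoHLin (r : ℕ) (e : Fin n → Fin n → ℂ) (lam : Fin n → ℂ) (i : Fin n)
    (m : ℤ) : Module.End ℂ (PXY n) :=
  (∑ k : Fin n, ∑ l : Fin n, if k ≤ l then (pairRoot n i k l : ℂ) • NopLin r k l m else 0) +
    bOp n e lam i m

theorem rhoHLin_apply (i : Fin n) (m : ℤ) (P : PXY n) :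
    rhoHLin r e lam i m P = rhoH n r e lam i m P := by
  rw [rhoHLin, rhoH, Hcal, LinearMap.add_apply, LinearMap.sum_apply]
  congr 1
  apply Finset.sum_congr rfl
  intro k _
  rw [LinearMap.sum_apply]
  apply Finset.sum_congr rfl
  intro l _
  split_ifs
  · rw [LinearMap.smul_apply, NopLin_apply]
  · rfl

theorem sum_ite_mul_of_mul {T V : Module.End ℂ (PXY n)} {N : Fin n → Fin n → Module.End ℂ (PXY n)}
    {k' l' : Fin n} (w : Fin n → Fin n → ℂ) (hkl : k' ≤ l')
    (h : ∀ k l, N k l * T = T * N k l + if k = k' ∧ l = l' then V else 0) :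
    (∑ k, ∑ l, if k ≤ l then w k l • N k l else 0) * T =
      T * (∑ k, ∑ l, if k ≤ l then w k l • N k l else 0) + w k' l' • V := by
  have hV : w k' l' • V = ∑ k, ∑ l, if k = k' ∧ l = l' then w k' l' • V else 0 := by
    rw [Finset.sum_eq_single k', Finset.sum_eq_single l', if_pos ⟨rfl, rfl⟩]
    · intro l _ hl
      exact if_neg fun h => hl h.2
    · exact fun h => absurd (Finset.mem_univ _) h
    · intro k _ hk
      exact Finset.sum_eq_zero fun l _ => if_neg fun h => hk h.1
    · exact fun h => absurd (Finset.mem_univ _) h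
  rw [hV]
  simp only [Finset.sum_mul, Finset.mul_sum, ← Finset.sum_add_distrib]
  apply Finset.sum_congr rfl
  intro k _
  apply Finset.sum_congr rfl
  intro l _
  by_cases hk : k = k' ∧ l = l'
  · obtain ⟨rfl, rfl⟩ := hk
    rw [if_pos hkl, if_pos ⟨rfl, rfl⟩, smul_mul_assoc, h, if_pos ⟨rfl, rfl⟩, smul_add,
      mul_smul_comm]
  · rw [if_neg hk, add_zero]
    split_ifs
    · rw [smul_mul_assoc, h, if_neg hk, add_zero, mul_smul_comm]
    · rw [zero_mul, mul_zero]

theorem isCartanMode_rhoHLin (i : Fin n) (m : ℤ) :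
    IsCartanMode r (fun k l => (pairRoot n i k l : ℂ)) m (rhoHLin r e lam i m) where
  mul_aOp {k l} hkl q := by
    rw [rhoHLin, add_mul, mul_add, (commute_bOp_aOp _ _ _ _ _).eq,
      sum_ite_mul_of_mul _ hkl fun k' l' => NopLin_mul_aOp k' l' k l m q]
    module
  mul_aStar {k l} hkl q := by
    rw [rhoHLin, add_mul, mul_add, (commute_bOp_aStar _ _ _ _ _).eq,
      sum_ite_mul_of_mul _ hkl fun k' l' => NopLin_mul_aStar k' l' k l m q]
    module

theorem rhoHLin_mul_bOp (i j : Fin n) (m q : ℤ) :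
    rhoHLin r e lam i m * bOp n e lam j q = bOp n e lam j q * rhoHLin r e lam i m +
      if m + q = 0 then ((m : ℂ) * ∑ k, e i k * e j k) • 1 else 0 := by
  rw [rhoHLin, add_mul, mul_add, bOp_mul_bOp]
  rw [sum_ite_mul_of_mul (k' := i) (l' := i) (V := 0) _ le_rfl fun k' l' => by
    rw [NopLin_mul_bOp, ite_self, add_zero]]
  module

end CartanMode

section Terms

variable {n r : ℕ} {w : Fin n → Fin n → ℂ} {m : ℤ} {D : Module.End ℂ (PXY n)}

theorem IsCartanMode.map_pairOp (hD : IsCartanMode r w m D) {k l k' l' : Fin n}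
    (hkl : k ≤ l) (hkl' : k' ≤ l') (hne : ¬ (k = k' ∧ l = l'))
    (hl : (l' : ℕ) + 1 ≤ r → (l : ℕ) + 1 ≤ r) (p : ℤ) (P : PXY n) :
    D (pairOp n r k l k' l' p P) =
      pairOp n r k l k' l' p (D P) + (w k' l' - w k l) • pairOp n r k l k' l' (m + p) P := by
  have hF (p) := pointwiseFinite_aOp_mul_aStar (r := r) hne hl p
  set N : ℤ → Module.End ℂ (PXY n) :=
    fun q => aOp n r k l q * aStar n r k' l' (m + p - q)
  let f : ℤ ≃ ℤ := Equiv.addRight m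
  have hNF : PointwiseFinite N := hF (m + p)
  have hfF := hNF.comp_equiv f
  have h (q : ℤ) : D * (aOp n r k l q * aStar n r k' l' (p - q)) =
      aOp n r k l q * aStar n r k' l' (p - q) * D +
        ((-w k l) • N (f q) + w k' l' • N q) := by
    change _ = _ +
      ((-w k l) • (aOp n r k l (q + m) * aStar n r k' l' (m + p - (q + m))) +
        w k' l' • (aOp n r k l q * aStar n r k' l' (m + p - q)))
    rw [show m + p - (q + m) = p - q by ring, show m + p - q = p - q + m by ring, ← mul_assoc,
      hD.mul_aOp hkl, add_mul, mul_assoc, hD.mul_aStar hkl', mul_add, smul_mul_assoc,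
      mul_smul_comm, mul_assoc]
    module
  change D (∑ᶠ q, (aOp n r k l q * aStar n r k' l' (p - q)) P) = _
  rw [map_finsum_of_mul_eq (hF p) h,
    finsum_add_apply (hfF.smul _) (hNF.smul _), finsum_smul_apply hfF, finsum_smul_apply hNF,
    PointwiseFinite.finsum_comp_equiv f]
  change pairOp n r k l k' l' p (D P) + ((-w k l) • pairOp n r k l k' l' (m + p) P +
    w k' l' • pairOp n r k l k' l' (m + p) P) = _
  module

theorem IsCartanMode.map_finsum_aStar_bOp (hD : IsCartanMode r w m D)
    {e : Fin n → Fin n → ℂ} {lam : Fin n → ℂ} {j k l : Fin n} (hkl : k ≤ l) {β : ℂ}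
    (hb : ∀ q, D * bOp n e lam j q = bOp n e lam j q * D + if m + q = 0 then β • 1 else 0)
    (p : ℤ) (P : PXY n) :
    D (∑ᶠ q, aStar n r k l q (bOp n e lam j (p - q) P)) =
      ∑ᶠ q, aStar n r k l q (bOp n e lam j (p - q) (D P)) +
        (w k l • ∑ᶠ q, aStar n r k l q (bOp n e lam j (m + p - q) P) +
          β • aStar n r k l (m + p) P) := by
  have hF (p) := pointwiseFinite_aStar_mul_bOp (r := r) e lam j k l p
  set N : ℤ → Module.End ℂ (PXY n) :=
    fun q => aStar n r k l q * bOp n e lam j (m + p - q)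
  let f : ℤ ≃ ℤ := Equiv.addRight m
  have hNF : PointwiseFinite N := hF (m + p)
  have hfF := hNF.comp_equiv f
  have hδ : PointwiseFinite fun q : ℤ => if q = m + p then β • aStar n r k l q else 0 :=
    PointwiseFinite.of_finset fun P => ⟨{m + p}, fun q hq => by
      by_contra hc
      rw [Finset.mem_singleton] at hc
      exact hq (by rw [if_neg hc, LinearMap.zero_apply])⟩
  have h (q : ℤ) : D * (aStar n r k l q * bOp n e lam j (p - q)) =
      aStar n r k l q * bOp n e lam j (p - q) * D +
        (w k l • N (f q) + if q = m + p then β • aStar n r k l q else 0) := by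
    change _ = _ + (w k l • (aStar n r k l (q + m) * bOp n e lam j (m + p - (q + m))) + _)
    rw [show m + p - (q + m) = p - q by ring, ← mul_assoc, hD.mul_aStar hkl, add_mul, mul_assoc,
      hb, mul_add, smul_mul_assoc, mul_assoc]
    have : m + (p - q) = 0 ↔ q = m + p := by omega
    simp only [this]
    split_ifs
    · rw [mul_smul_comm, mul_one]
      module
    · rw [mul_zero]
      module
  change D (∑ᶠ q, (aStar n r k l q * bOp n e lam j (p - q)) P) = _
  rw [map_finsum_of_mul_eq (hF p) h,
    finsum_add_apply (hfF.smul _) hδ, finsum_smul_apply hfF,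
    PointwiseFinite.finsum_comp_equiv f,
    finsum_eq_single (fun q => (if q = m + p then β • aStar n r k l q else 0 : Module.End ℂ _) P)
      (m + p) fun q hq => by rw [if_neg hq, LinearMap.zero_apply], if_pos rfl]
  rfl

theorem mul_mul_mul_of_graded {R : Type*} [Ring R] [Algebra ℂ R] {D A A' S S' T T' : R} {u v : ℂ}
    (hA : D * A = A * D + (-v) • A') (hS : D * S = S * D + u • S')
    (hT : D * T = T * D + v • T') :
    D * (S * T * A) =
      S * T * A * D + (u • (S' * T * A) + v • (S * T' * A) + (-v) • (S * T * A')) := by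
  rw [← mul_assoc, ← mul_assoc, hS, add_mul, add_mul, mul_assoc S D, hT, mul_add, add_mul,
    ← mul_assoc, mul_assoc _ D A, hA]
  simp only [mul_add, smul_mul_assoc, mul_smul_comm, mul_assoc]
  module

theorem mul_mul_mul_of_graded' {R : Type*} [Ring R] [Algebra ℂ R] {D A A' S S' T T' : R}
    {u v : ℂ} (hA : D * A = A * D + (-v) • A') (hS : D * S = S * D + u • S')
    (hT : D * T = T * D + v • T') :
    D * (A * (S * T)) =
      A * (S * T) * D +
        (u • (A * (S' * T)) + v • (A * (S * T')) + (-v) • (A' * (S * T))) := by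
  rw [← mul_assoc, ← mul_assoc, hA, add_mul, add_mul, mul_assoc A D, hS, mul_add, add_mul,
    ← mul_assoc, mul_assoc _ D T, hT]
  simp only [mul_add, smul_mul_assoc, mul_smul_comm, mul_assoc]
  module

theorem aOp_mul_aStar_mul_aStar (i k l : Fin n) (t q s : ℤ) :
    aOp n r k l q * (aStar n r i i t * aStar n r k l s) =
      aStar n r i i t * aStar n r k l s * aOp n r k l q +
        ((if k = i ∧ l = i ∧ q + t = 0 then aStar n r k l s else 0) +
          if q + s = 0 then aStar n r i i t else 0) := by
  rw [← mul_assoc, aOp_mul_aStar, add_mul, mul_assoc, aOp_mul_aStar, mul_add]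
  simp only [true_and]
  split_ifs <;> simp only [mul_one, one_mul, zero_mul, mul_zero, mul_assoc] <;> module

theorem IsCartanMode.mul_cubicProd (hD : IsCartanMode r w m D) {k l : Fin n} (hkl : k ≤ l)
    (i : Fin n) (t q s : ℤ) :
    D * cubicProd r i k l t q s = cubicProd r i k l t q s * D +
      (w i i • cubicProd r i k l (t + m) q s + w k l • cubicProd r i k l t q (s + m) +
        (-w k l) • cubicProd r i k l t (q + m) s +
        ((if (l : ℕ) + 1 ≤ r then w k l else 0) *
            ((if 0 ≤ q then 1 else 0) - if 0 ≤ q + m then 1 else 0)) •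
          ((if k = i ∧ l = i ∧ q + m + t = 0 then aStar n r k l s else 0) +
            if q + m + s = 0 then aStar n r i i t else 0)) := by
  have hA := hD.mul_aOp hkl q
  have hS := hD.mul_aStar (le_refl i) t
  have hT := hD.mul_aStar hkl s
  have h1 := mul_mul_mul_of_graded hA hS hT
  have h2 := mul_mul_mul_of_graded' hA hS hT
  have h3 := aOp_mul_aStar_mul_aStar (r := r) i k l t (q + m) s
  simp only [cubicProd]
  by_cases hl : (l : ℕ) + 1 ≤ r
  · simp only [hl, and_true, if_true]
    by_cases hq : 0 ≤ q <;> by_cases hqm : 0 ≤ q + m <;> simp only [hq, hqm, if_true, if_false]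
    · rw [h1]
      module
    · rw [h1, h3]
      module
    · rw [h2, h3]
      module
    · rw [h2]
      module
  · simp only [hl, and_false, if_false]
    rw [h2]
    module

theorem IsCartanMode.map_cubic (hD : IsCartanMode r w m D) {i k l : Fin n} (hkl : k ≤ l)
    (hil : (i : ℕ) + 1 ≤ r → (l : ℕ) + 1 ≤ r) (p : ℤ) (P : PXY n) :
    D (cubic n r i k l p P) = cubic n r i k l p (D P) + (w i i • cubic n r i k l (m + p) P -
      ((m : ℂ) * ((if (l : ℕ) + 1 ≤ r then w k l else 0) *
        (1 + if k = i ∧ l = i then 1 else 0))) • aStar n r i i (m + p) P) := by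
  set c : ℂ := if (l : ℕ) + 1 ≤ r then w k l else 0
  set ε : ℤ → ℂ := fun q => (if 0 ≤ q then 1 else 0) - if 0 ≤ q + m then 1 else 0
  set N : ℤ × ℤ → Module.End ℂ (PXY n) :=
    fun q => cubicProd r i k l q.1 q.2 (m + p - q.1 - q.2)
  set V : Module.End ℂ (PXY n) := aStar n r i i (m + p) with hV
  set δ : ℂ := if k = i ∧ l = i then 1 else 0 with hδ
  have hF (p) := pointwiseFinite_cubicProd hil (k := k) p
  have hNF : PointwiseFinite N := hF (m + p)
  have hεF : ε.HasFiniteSupport := hasFiniteSupport_indicator_sub_shift m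
  let f : ℤ × ℤ ≃ ℤ × ℤ := (Equiv.addRight m).prodCongr (Equiv.refl ℤ)
  let g : ℤ × ℤ ≃ ℤ × ℤ := (Equiv.refl ℤ).prodCongr (Equiv.addRight m)
  let E : ℤ × ℤ → Module.End ℂ (PXY n) := fun q => (c * ε q.2) •
    ((if k = i ∧ l = i ∧ q.2 + m + q.1 = 0 then aStar n r k l (p - q.1 - q.2) else 0) +
      if q.2 + m + (p - q.1 - q.2) = 0 then aStar n r i i q.1 else 0)
  have hEP (Q : PXY n) (q : ℤ × ℤ) : E q Q = (c * δ) • (ε q.2 • if q.1 = -(q.2 + m) then V Q else 0) +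
      c • (ε q.2 • if q.1 = m + p then V Q else 0) := by
    have h1 : q.2 + m + q.1 = 0 ↔ q.1 = -(q.2 + m) := by omega
    have h2 : q.2 + m + (p - q.1 - q.2) = 0 ↔ q.1 = m + p := by omega
    have h3 : (if k = i ∧ l = i ∧ q.2 + m + q.1 = 0 then aStar n r k l (p - q.1 - q.2) else 0) Q =
        δ • if q.1 = -(q.2 + m) then V Q else 0 := by
      by_cases hki : k = i ∧ l = i
      · obtain ⟨rfl, rfl⟩ := hki
        simp only [true_and, and_self, if_true, one_smul, hδ, h1]
        split_ifs with h
        · rw [h, hV, show p - -(q.2 + m) - q.2 = m + p by ring]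
        · rfl
      · rw [hδ, if_neg hki, if_neg (by tauto), zero_smul, LinearMap.zero_apply]
    have h4 : (if q.2 + m + (p - q.1 - q.2) = 0 then aStar n r i i q.1 else 0) Q =
        if q.1 = m + p then V Q else 0 := by
      simp only [h2]
      split_ifs with h
      · rw [h]
      · rfl
    simp only [E, LinearMap.smul_apply, LinearMap.add_apply, h3, h4]
    module
  have hgr (Q : PXY n) (g : ℤ → ℤ) := hasFiniteSupport_graph hεF g (V Q)
  have hsm {F : ℤ × ℤ → PXY n} (hF : F.HasFiniteSupport) (a : ℂ) :
      (fun q => a • F q).HasFiniteSupport := hF.subset fun q hq hq' => hq (by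
    simp only at hq' ⊢
    rw [hq', smul_zero])
  have hEsum : ∑ᶠ q, E q P = (-(m : ℂ) * (c * (1 + δ))) • V P := by
    rw [finsum_congr (hEP P), finsum_add_distrib (hsm (hgr P fun q => -(q + m)) _)
      (hsm (hgr P fun _ => m + p) _), ← smul_finsum' _ (hgr P fun q => -(q + m)),
      ← smul_finsum' _ (hgr P fun _ => m + p), finsum_graph hεF (fun q => -(q + m)),
      finsum_graph hεF (fun _ => m + p),
      finsum_indicator_sub_shift]
    module
  have hEF : PointwiseFinite E := fun Q => by
    rw [funext (hEP Q)]
    refine ((hsm (hgr Q fun q => -(q + m)) (c * δ)).union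
      (hsm (hgr Q fun _ => m + p) c)).subset fun q hq => ?_
    by_contra hc
    simp only [Set.mem_union, Function.mem_support, not_or, not_not] at hc
    exact hq (by simp only [hc.1, hc.2, add_zero])
  have h (q : ℤ × ℤ) : D * cubicProd r i k l q.1 q.2 (p - q.1 - q.2) =
      cubicProd r i k l q.1 q.2 (p - q.1 - q.2) * D +
        (w i i • N (f q) + w k l • N q + (-w k l) • N (g q) + E q) := by
    rw [hD.mul_cubicProd hkl]
    have hf : N (f q) = cubicProd r i k l (q.1 + m) q.2 (p - q.1 - q.2) :=
      congrArg (cubicProd r i k l (q.1 + m) q.2)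
        (by ring : m + p - (q.1 + m) - q.2 = p - q.1 - q.2)
    have hg : N (g q) = cubicProd r i k l q.1 (q.2 + m) (p - q.1 - q.2) :=
      congrArg (cubicProd r i k l q.1 (q.2 + m))
        (by ring : m + p - q.1 - (q.2 + m) = p - q.1 - q.2)
    have hid : N q = cubicProd r i k l q.1 q.2 (p - q.1 - q.2 + m) :=
      congrArg (cubicProd r i k l q.1 q.2) (by ring : m + p - q.1 - q.2 = p - q.1 - q.2 + m)
    rw [hf, hg, hid]
  have hfF := hNF.comp_equiv f
  have hgF := hNF.comp_equiv g
  rw [cubic_eq_finsum, cubic_eq_finsum, cubic_eq_finsum, map_finsum_of_mul_eq (hF p) h,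
    finsum_add_apply (((hfF.smul _).add (hNF.smul _)).add (hgF.smul _)) hEF,
    finsum_add_apply ((hfF.smul _).add (hNF.smul _)) (hgF.smul _),
    finsum_add_apply (hfF.smul _) (hNF.smul _), finsum_smul_apply hfF, finsum_smul_apply hNF,
    finsum_smul_apply hgF, PointwiseFinite.finsum_comp_equiv f,
    PointwiseFinite.finsum_comp_equiv g, hEsum]
  module

end Terms

section Weights

variable {n : ℕ}

theorem pairRoot_eq (i : Fin n) {k l : Fin n} (hkl : k ≤ l) :
    pairRoot n i k l = (if (k : ℕ) = i then 1 else 0) - (if (k : ℕ) = i + 1 then 1 else 0) -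
      (if (l : ℕ) + 1 = i then 1 else 0) + (if (l : ℕ) = i then 1 else 0) := by
  have hsum : pairRoot n i k l = ∑ s ∈ Finset.Icc (k : ℕ) l,
      if (i : ℕ) = s then (2 : ℤ) else if (i : ℕ) + 1 = s ∨ s + 1 = i then -1 else 0 := by
    rw [← Fin.map_valEmbedding_Icc, Finset.sum_map]
    refine Finset.sum_congr rfl fun s _ => ?_
    simp only [cartan, Fin.ext_iff, Fin.valEmbedding_apply]
  rw [hsum]
  have h : ∀ a b : ℕ, a ≤ b → (∑ s ∈ Finset.Icc a b,
      if (i : ℕ) = s then (2 : ℤ) else if (i : ℕ) + 1 = s ∨ s + 1 = i then -1 else 0) =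
      (if a = i then 1 else 0) - (if a = i + 1 then 1 else 0) -
        (if b + 1 = i then 1 else 0) + (if b = i then 1 else 0) := by
    intro a b hab
    induction b, hab using Nat.le_induction with
    | base =>
      rw [Finset.Icc_self, Finset.sum_singleton]
      split_ifs <;> omega
    | succ b hab ih =>
      rw [Finset.sum_Icc_succ_top (by omega), ih]
      split_ifs <;> omega
  exact h k l hkl

theorem pairRoot_self (i j : Fin n) : pairRoot n i j j = cartan n i j := by
  rw [pairRoot, Finset.Icc_self, Finset.sum_singleton]

theorem pairRoot_sub_pairRoot_pred (i : Fin n) {j k l : Fin n} (hkl : k ≤ l)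
    (hl : (l : ℕ) + 1 = j) : pairRoot n i k j - pairRoot n i k l = cartan n i j := by
  have hkj : k ≤ j := by omega
  rw [pairRoot_eq i hkl, pairRoot_eq i hkj, cartan]
  simp only [Fin.ext_iff]
  split_ifs <;> omega

theorem pairRoot_sub_pairRoot_succ (i : Fin n) {j k l : Fin n} (hkl : k ≤ l)
    (hk : (j : ℕ) + 1 = k) : pairRoot n i j l - pairRoot n i k l = cartan n i j := by
  have hjl : j ≤ l := by omega
  rw [pairRoot_eq i hkl, pairRoot_eq i hjl, cartan]
  simp only [Fin.ext_iff]
  split_ifs <;> omega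

theorem sum_pairRoot (i l : Fin n) {J : ℕ} (hJ : J ≤ (l : ℕ) + 1) :
    (∑ k : Fin n, if (k : ℕ) < J then pairRoot n i k l else 0) =
      (if (i : ℕ) < J then 1 else 0) - (if (i : ℕ) + 1 < J then 1 else 0) +
        J * ((if (l : ℕ) = i then 1 else 0) - (if (l : ℕ) + 1 = i then 1 else 0)) := by
  set f : ℕ → ℤ := fun k => (if k = (i : ℕ) then 1 else 0) - (if k = (i : ℕ) + 1 then 1 else 0) -
    (if (l : ℕ) + 1 = i then 1 else 0) + (if (l : ℕ) = i then 1 else 0) with hf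
  have h1 : (∑ k : Fin n, if (k : ℕ) < J then pairRoot n i k l else 0) =
      ∑ k : Fin n, (fun k => if k < J then f k else 0) (k : ℕ) := by
    refine Finset.sum_congr rfl fun k _ => ?_
    by_cases hk : (k : ℕ) < J
    · rw [if_pos hk, pairRoot_eq i (by omega)]
      simp only [hk, if_true, hf]
    · simp only [hk, if_false]
  have h2 : (Finset.range n).filter (· < J) = Finset.range J := by
    ext k
    simp only [Finset.mem_filter, Finset.mem_range]
    omega
  rw [h1, Fin.sum_univ_eq_sum_range (fun k => if k < J then f k else 0), ← Finset.sum_filter, h2]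
  simp only [hf, Finset.sum_add_distrib, Finset.sum_sub_distrib, Finset.sum_ite_eq',
    Finset.mem_range, Finset.sum_const, Finset.card_range, nsmul_eq_mul]
  ring

/-- The vanishing of the anomaly in the commutator of `ρ(H_i)` with `ρ(E_j)`. -/
theorem anomaly_eq (r : ℕ) (γ : ℂ) (i j : Fin n) :
    (∑ k : Fin n, if k ≤ j then ((if (j : ℕ) + 1 ≤ r then (pairRoot n i k j : ℂ) else 0) *
        (1 + if k = j ∧ j = j then 1 else 0)) else 0) -
      (∑ k : Fin n, if h : k < j then
        ((if (j : ℕ) - 1 + 1 ≤ r then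
          (pairRoot n i k (⟨(j : ℕ) - 1, by have := j.isLt; omega⟩ : Fin n) : ℂ) else 0) *
        (1 + if k = j ∧ (⟨(j : ℕ) - 1, by have := j.isLt; omega⟩ : Fin n) = j then 1 else 0))
        else 0) =
    Bmat n r γ i j + ((if r < (j : ℕ) + 1 then (r : ℂ) + 1 else 0) +
      (if (j : ℕ) + 1 ≤ r then ((j : ℕ) : ℂ) + 2 else 0) - γ ^ 2) * cartan n i j := by
  set j' : Fin n := ⟨(j : ℕ) - 1, by have := j.isLt; omega⟩
  have hjv : (j' : ℕ) = j - 1 := rfl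
  have h1 : (∑ k : Fin n, if h : k < j then
      ((if (j : ℕ) - 1 + 1 ≤ r then (pairRoot n i k j' : ℂ) else 0) *
        (1 + if k = j ∧ j' = j then 1 else 0)) else 0) = if (j : ℕ) ≤ r then
      ((∑ k : Fin n, if (k : ℕ) < (j : ℕ) then pairRoot n i k j' else 0 : ℤ) : ℂ) else 0 := by
    have hne (k : Fin n) (hk : k < j) : ¬ (k = j ∧ j' = j) := fun h => hk.ne h.1
    by_cases hjr : (j : ℕ) ≤ r
    · rw [if_pos hjr, Int.cast_sum]
      refine Finset.sum_congr rfl fun k _ => ?_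
      by_cases hk : k < j
      · rw [dif_pos hk, if_pos (show (k : ℕ) < j from hk), if_pos (by omega), if_neg (hne k hk),
          add_zero, mul_one]
      · rw [dif_neg hk, if_neg (show ¬ (k : ℕ) < j from hk), Int.cast_zero]
    · rw [if_neg hjr]
      refine Finset.sum_eq_zero fun k _ => ?_
      split_ifs <;> first | omega | simp only [zero_mul]
  have h2 : (∑ k : Fin n, if k ≤ j then
      ((if (j : ℕ) + 1 ≤ r then (pairRoot n i k j : ℂ) else 0) *
        (1 + if k = j ∧ j = j then 1 else 0)) else 0) = if (j : ℕ) + 1 ≤ r then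
      ((∑ k : Fin n, if (k : ℕ) < (j : ℕ) + 1 then pairRoot n i k j else 0 : ℤ) : ℂ) +
        cartan n i j else 0 := by
    split_ifs with hjr
    · have hj : (cartan n i j : ℂ) = ∑ k : Fin n, if k = j then (cartan n i j : ℂ) else 0 := by
        rw [Finset.sum_ite_eq' Finset.univ j, if_pos (Finset.mem_univ j)]
      rw [Int.cast_sum, hj, ← Finset.sum_add_distrib]
      refine Finset.sum_congr rfl fun k _ => ?_
      by_cases hk : k ≤ j
      · rw [if_pos hk, if_pos (show (k : ℕ) < j + 1 by omega)]
        by_cases hkj : k = j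
        · subst hkj
          rw [if_pos ⟨rfl, rfl⟩, if_pos rfl, pairRoot_self]
          ring
        · rw [if_neg fun h => hkj h.1, if_neg hkj, add_zero, add_zero, mul_one]
      · rw [if_neg hk, if_neg (show ¬ (k : ℕ) < j + 1 by omega), if_neg (by omega), Int.cast_zero,
          add_zero]
    · refine Finset.sum_eq_zero fun k _ => ?_
      split_ifs <;> simp only [zero_mul]
  rw [h1, h2, sum_pairRoot i j' (by omega), sum_pairRoot i j le_rfl, Bmat, hjv, cartan]
  simp only [Fin.ext_iff]
  generalize (i : ℕ) = a
  generalize (j : ℕ) = b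
  have hpred : (b : ℤ) * ((if b - 1 = a then 1 else 0) - (if b - 1 + 1 = a then 1 else 0)) =
      b * ((if b = a + 1 then 1 else 0) - (if b = a then 1 else 0)) := by
    rcases b.eq_zero_or_pos with rfl | hb
    · simp only [Nat.cast_zero, zero_mul]
    · congr 1
      split_ifs <;> omega
  rw [hpred]
  have hab : (a + 1 < b ∨ b + 1 < a) ∨ a = b ∨ a + 1 = b ∨ b + 1 = a := by omega
  rcases lt_trichotomy b r with hb | rfl | hb <;> rcases hab with (h | h) | rfl | rfl | rfl <;>
    simp (disch := omega) only [if_pos, if_neg, true_or, or_true, and_self] <;> push_cast <;>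
    ring

end Weights

theorem map_sum_of_map {n : ℕ} {D : Module.End ℂ (PXY n)} {f g h : Fin n → PXY n} {a c : ℂ}
    {d : Fin n → ℂ} {v : PXY n} (hf : ∀ k, D (f k) = g k + (a • h k - (c * d k) • v)) :
    D (∑ k, f k) = ∑ k, g k + (a • ∑ k, h k - (c * ∑ k, d k) • v) := by
  rw [map_sum, Finset.smul_sum, Finset.mul_sum, Finset.sum_smul, ← Finset.sum_sub_distrib,
    ← Finset.sum_add_distrib]
  exact Finset.sum_congr rfl fun k _ => hf k

theorem map_sum_of_map_eq_add_smul {n : ℕ} {D : Module.End ℂ (PXY n)} {f g h : Fin n → PXY n}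
    {a : ℂ} (hf : ∀ k, D (f k) = g k + a • h k) :
    D (∑ k, f k) = ∑ k, g k + a • ∑ k, h k := by
  rw [map_sum, Finset.smul_sum, ← Finset.sum_add_distrib]
  exact Finset.sum_congr rfl fun k _ => hf k

/-- R2: `[ρ(H_i)_m, ρ(E_j)_p] = (α_i|α_j) ρ(E_j)_{m+p}`. -/
theorem wakimoto_R2 (n r : ℕ) (hn : 1 ≤ n) (hr : r ≤ n)
    (γ : ℂ) (hγ : γ ≠ 0) (e : Fin n → Fin n → ℂ) (lam : Fin n → ℂ)
    (he : ∀ i j, ∑ k, e i k * e j k = Bmat n r γ i j)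
    (i j : Fin n) (m p : ℤ) (P : PXY n) :
    rhoH n r e lam i m (rhoE n r γ e lam j p P)
        - rhoE n r γ e lam j p (rhoH n r e lam i m P) =
      (cartan n i j : ℂ) • rhoE n r γ e lam j (m + p) P := by
  have hD := isCartanMode_rhoHLin (r := r) (e := e) (lam := lam) i m
  have hDb (q : ℤ) := rhoHLin_mul_bOp (r := r) (e := e) (lam := lam) i j m q
  rw [← rhoHLin_apply, ← rhoHLin_apply]
  set D := rhoHLin r e lam i m
  have hw : (pairRoot n i j j : ℂ) = cartan n i j := by rw [pairRoot_self]
  have hcubic {k l : Fin n} (hkl : k ≤ l) (hl : (j : ℕ) + 1 ≤ r → (l : ℕ) + 1 ≤ r) :=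
    hD.map_cubic hkl hl p P
  simp only [hw] at hcubic
  have h1 := map_sum_of_map (D := D) (f := fun k => if h : k < j then
      cubic n r j k (⟨(j : ℕ) - 1, by have := j.isLt; omega⟩ : Fin n) p P else 0)
    (g := fun k => if h : k < j then
      cubic n r j k (⟨(j : ℕ) - 1, by have := j.isLt; omega⟩ : Fin n) p (D P) else 0)
    (h := fun k => if h : k < j then
      cubic n r j k (⟨(j : ℕ) - 1, by have := j.isLt; omega⟩ : Fin n) (m + p) P else 0)
    (a := cartan n i j) (c := m) (v := aStar n r j j (m + p) P)
    (d := fun k => if h : k < j then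
        ((if (j : ℕ) - 1 + 1 ≤ r then
          (pairRoot n i k (⟨(j : ℕ) - 1, by have := j.isLt; omega⟩ : Fin n) : ℂ) else 0) *
        (1 + if k = j ∧ (⟨(j : ℕ) - 1, by have := j.isLt; omega⟩ : Fin n) = j then 1 else 0))
        else 0) fun k => by
      by_cases hk : k < j
      · simp only [dif_pos hk]
        exact hcubic (Fin.le_def.2 (Nat.le_sub_one_of_lt hk)) fun h => by
          change (j : ℕ) - 1 + 1 ≤ r
          omega
      · simp only [dif_neg hk]
        rw [map_zero]
        module
  have h2 := map_sum_of_map (D := D) (f := fun k => if k ≤ j then cubic n r j k j p P else 0)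
    (g := fun k => if k ≤ j then cubic n r j k j p (D P) else 0)
    (h := fun k => if k ≤ j then cubic n r j k j (m + p) P else 0)
    (a := cartan n i j) (c := m) (v := aStar n r j j (m + p) P)
    (d := fun k => if k ≤ j then ((if (j : ℕ) + 1 ≤ r then (pairRoot n i k j : ℂ) else 0) *
        (1 + if k = j ∧ j = j then 1 else 0)) else 0) fun k => by
      by_cases hk : k ≤ j
      · simpa only [if_pos hk, and_true] using hcubic hk id
      · simp only [if_neg hk]
        rw [map_zero]
        module
  have h3 : D (sumHigh n r j p P) =
      sumHigh n r j p (D P) + (cartan n i j : ℂ) • sumHigh n r j (m + p) P := by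
    refine map_sum_of_map_eq_add_smul fun k => ?_
    by_cases hk : j < k
    · simp only [dif_pos hk]
      have hsucc : (⟨(j : ℕ) + 1, (Nat.succ_le_of_lt hk).trans_lt k.isLt⟩ : Fin n) ≤ k :=
        Nat.succ_le_of_lt hk
      rw [hD.map_pairOp hsucc hk.le (fun h => by simp [Fin.ext_iff] at h) id, ← Int.cast_sub,
        pairRoot_sub_pairRoot_succ i hsucc rfl]
    · simp only [dif_neg hk]
      rw [map_zero]
      module
  have h4 : D (sumLow n r j p P) =
      sumLow n r j p (D P) + (cartan n i j : ℂ) • sumLow n r j (m + p) P := by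
    refine map_sum_of_map_eq_add_smul fun k => ?_
    by_cases hk : k < j
    · simp only [dif_pos hk]
      have hj0 : 0 < (j : ℕ) := (Nat.zero_le k).trans_lt hk
      have hj1 : (j : ℕ) - 1 + 1 = j := Nat.sub_add_cancel hj0
      have hpred : k ≤ (⟨(j : ℕ) - 1, (Nat.sub_le _ _).trans_lt j.isLt⟩ : Fin n) :=
        Nat.le_sub_one_of_lt hk
      rw [hD.map_pairOp hpred hk.le
        (fun h => by
          have := congrArg Fin.val h.2
          simp only at this
          omega)
        (fun h => by
          change (j : ℕ) - 1 + 1 ≤ r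
          omega), ← Int.cast_sub, pairRoot_sub_pairRoot_pred i hpred hj1]
    · simp only [dif_neg hk]
      rw [map_zero]
      module
  have h5 := hD.map_finsum_aStar_bOp (le_refl j) hDb p P
  have h6 : D (aStar n r j j p P) = aStar n r j j p (D P) +
      (cartan n i j : ℂ) • aStar n r j j (m + p) P := by
    rw [add_comm m p, ← hw]
    exact LinearMap.congr_fun (hD.mul_aStar (le_refl j) p) P
  have hanomaly := anomaly_eq r γ i j
  rw [he, hw] at h5
  rw [rhoE, rhoE, rhoE, map_sub, map_sub, map_sub, map_add, map_sub, map_smul, map_smul, h1, h2,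
    h3, h4, h5, h6]
  rw [sub_eq_iff_eq_add.1 hanomaly, Int.cast_add]
  module
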